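/- There exists a badly approximable extremal real number ξ such that no real number of the form (aξ+b)/(cξ+d), where the matrix (a b; c d) belongs to GL₂(ℚ), is an extremal real number possessing an associated Fibonacci sequence all of whose terms lie in GL₂(ℤ). -/

import Mathlib

open Matrix

/-- 2×2 integer matrices. -/
abbrev M2 : Type := Matrix (Fin 2) (Fin 2) ℤ

/-- The content of an integer matrix: the gcd of its coefficients. -/
def content (A : M2) : ℕ :=
  Nat.gcd (Nat.gcd (A 0 0).natAbs (A 0 1).natAbs) (Nat.gcd (A 1 0).natAbs (A 1 1).natAbs)

/-- A matrix is primitive if its content is 1. -/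
def Primitive (A : M2) : Prop := content A = 1

/-- Membership in 𝒫: primitive with nonzero determinant. -/
def MemP (A : M2) : Prop := Primitive A ∧ A.det ≠ 0

/-- `A^red`: the primitive matrix such that `A = content A • A^red`. -/
def red (A : M2) : M2 := Matrix.of fun i j => A i j / (content A : ℤ)

/-- The group operation of 𝒫: `A * B = (AB)^red`. -/
def pmul (A B : M2) : M2 := red (A * B)

/-- A Fibonacci sequence in 𝒫 (indices from 1). -/
def IsFibP (W : ℕ → M2) : Prop :=
  (∀ i, 1 ≤ i → MemP (W i)) ∧ ∀ i, 1 ≤ i → W (i + 2) = pmul (W (i + 1)) (W i)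

/-- Admissibility of a Fibonacci sequence in 𝒫: there is a non-symmetric,
non-skew-symmetric N ∈ 𝒫 such that W_i N_i is symmetric for all i ≥ 1,
where N_i = ᵗN for odd i and N_i = N for even i. -/
def AdmissibleFib (W : ℕ → M2) : Prop :=
  ∃ N : M2, MemP N ∧ N ≠ Nᵀ ∧ N ≠ -Nᵀ ∧
    ∀ i, 1 ≤ i → (W i * (if i % 2 = 1 then Nᵀ else N)).IsSymm

/-- The norm of an integer 2×2 matrix: max absolute value of coefficients, as a real. -/
noncomputable def mnorm (A : M2) : ℝ :=
  max (max |(A 0 0 : ℝ)| |(A 0 1 : ℝ)|) (max |(A 1 0 : ℝ)| |(A 1 1 : ℝ)|)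

/-- The sequence is unbounded in norm. -/
def UnboundedSeq (W : ℕ → M2) : Prop := ∀ C : ℝ, ∃ i, 1 ≤ i ∧ C < mnorm (W i)

/-- The golden ratio γ = (1+√5)/2. -/
noncomputable def gam : ℝ := (1 + Real.sqrt 5) / 2

/-- Norm of the row vector (ξ, -1)·A. -/
noncomputable def xiNorm (ξ : ℝ) (A : M2) : ℝ :=
  max |ξ * (A 0 0 : ℝ) - (A 1 0 : ℝ)| |ξ * (A 0 1 : ℝ) - (A 1 1 : ℝ)|

/-- ξ is extremal: neither rational nor quadratic over ℚ, and for each X ≥ 1 the system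
|x₀| ≤ X, |x₀ξ - x₁| ≤ c X^(-1/γ), |x₀ξ² - x₂| ≤ c X^(-1/γ) has a nonzero integer solution. -/
def IsExtremal (ξ : ℝ) : Prop :=
  (∀ a b c : ℚ, ¬(a = 0 ∧ b = 0 ∧ c = 0) → (a : ℝ) * ξ ^ 2 + (b : ℝ) * ξ + (c : ℝ) ≠ 0) ∧
  ∃ c : ℝ, 0 < c ∧ ∀ X : ℝ, 1 ≤ X → ∃ x₀ x₁ x₂ : ℤ,
    ¬(x₀ = 0 ∧ x₁ = 0 ∧ x₂ = 0) ∧ |(x₀ : ℝ)| ≤ X ∧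
    |(x₀ : ℝ) * ξ - (x₁ : ℝ)| ≤ c * X ^ (-1 / gam) ∧
    |(x₀ : ℝ) * ξ ^ 2 - (x₂ : ℝ)| ≤ c * X ^ (-1 / gam)

/-- The Fibonacci sequence `W` in 𝒫 is associated to the extremal real number ξ:
it is an unbounded admissible Fibonacci sequence in 𝒫 with
‖W_{i+1}‖ ≍ ‖W_i‖^γ, ‖(ξ,-1)W_i‖ ≍ ‖W_i‖⁻¹ and |det W_i| ≍ 1. -/
def IsAssociated (ξ : ℝ) (W : ℕ → M2) : Prop :=
  IsFibP W ∧ UnboundedSeq W ∧ AdmissibleFib W ∧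
  ∃ c₁ c₂ c₃ c₄ c₅ c₆ : ℝ, 0 < c₁ ∧ 0 < c₂ ∧ 0 < c₃ ∧ 0 < c₄ ∧ 0 < c₅ ∧ 0 < c₆ ∧
    ∀ i, 1 ≤ i →
      c₁ * mnorm (W i) ^ gam ≤ mnorm (W (i + 1)) ∧
      mnorm (W (i + 1)) ≤ c₂ * mnorm (W i) ^ gam ∧
      c₃ * (mnorm (W i))⁻¹ ≤ xiNorm ξ (W i) ∧
      xiNorm ξ (W i) ≤ c₄ * (mnorm (W i))⁻¹ ∧
      c₅ ≤ |((W i).det : ℝ)| ∧ |((W i).det : ℝ)| ≤ c₆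

/-- Membership in GL₂(ℤ): integer matrix of determinant ±1. -/
def InGL2Z (A : M2) : Prop := A.det = 1 ∨ A.det = -1

/-- ξ is badly approximable: irrational and |ξ - p/q| > c/q² for all rationals p/q. -/
def BadlyApprox (ξ : ℝ) : Prop :=
  Irrational ξ ∧ ∃ c : ℝ, 0 < c ∧ ∀ p q : ℤ, q ≠ 0 → c / (q : ℝ) ^ 2 < |ξ - (p : ℝ) / (q : ℝ)|

/-- Partial quotients of the continued fraction expansion: `cfA n ξ` is `aₙ`
where ξ = [a₀, a₁, a₂, …]. -/
noncomputable def cfA : ℕ → ℝ → ℤ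
  | 0, ξ => ⌊ξ⌋
  | n + 1, ξ => cfA n (ξ - ⌊ξ⌋)⁻¹

/-- A Fibonacci sequence of words (indices from 1). -/
def FibWordSeq {α : Type} (w : ℕ → List α) : Prop := ∀ i, 1 ≤ i → w (i + 2) = w (i + 1) ++ w i

/-- `b` (indexed from 1: the limit word is b₁b₂b₃…) is the infinite limit word of the
sequence of words `w`: every `w k` (k ≥ 2) is a prefix of it, and their lengths are unbounded. -/
def IsLimitWord {α : Type} (w : ℕ → List α) (b : ℕ → α) : Prop :=
  (∀ n : ℕ, ∃ k, 2 ≤ k ∧ n ≤ (w k).length) ∧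
  ∀ k, 2 ≤ k → ∀ j, (h : j < (w k).length) → (w k).get ⟨j, h⟩ = b (j + 1)

/-- The Fibonacci sequence of words over the alphabet E = {a, b} (with `b = false`,
`a = true`): w₁ = b, w₂ = a, w_{k+2} = w_{k+1} w_k.  Its limit is f_{a,b}. -/
def fw : ℕ → List Bool
  | 0 => []
  | 1 => [false]
  | 2 => [true]
  | n + 3 => fw (n + 2) ++ fw (n + 1)

/-- The prefix of length `i` of the infinite Fibonacci word `f_{a,b}`
(note `fw (i+2)` is a prefix of `f_{a,b}` of length ≥ i). -/
def fpref (i : ℕ) : List Bool := (fw (i + 2)).take i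

/-- The monoid morphism Φ : E* → (𝒫, *) with Φ(b) = W₁, Φ(a) = W₂
(the letter `b` is `false` and `a` is `true`). -/
def PhiW (W1 W2 : M2) : List Bool → M2
  | [] => 1
  | x :: u => pmul (if x then W2 else W1) (PhiW W1 W2 u)

/-- The set 𝒮₁ of real matrices (a b; c d) with a ≥ max{b,c} and min{b,c} ≥ d ≥ 0. -/
def S1 : Set (Matrix (Fin 2) (Fin 2) ℝ) :=
  {A | max (A 0 1) (A 1 0) ≤ A 0 0 ∧ A 1 1 ≤ min (A 0 1) (A 1 0) ∧ 0 ≤ A 1 1}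

/-- The set 𝒮 = 𝒮₁ ∩ GL₂(ℤ), viewed as a set of integer matrices. -/
def Sset : Set M2 :=
  {A | (A.map (Int.cast : ℤ → ℝ)) ∈ S1 ∧ (A.det = 1 ∨ A.det = -1)}

/-- ξ is an extremal real number with an associated Fibonacci sequence in GL₂(ℤ). -/
def HasGLAssoc (ξ : ℝ) : Prop :=
  IsExtremal ξ ∧ ∃ W : ℕ → M2, IsAssociated ξ W ∧ ∀ i, 1 ≤ i → InGL2Z (W i)

/-- ξ is an extremal real number with an associated Fibonacci sequence in 𝒮. -/
def HasSAssoc (ξ : ℝ) : Prop :=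
  IsExtremal ξ ∧ ∃ W : ℕ → M2, IsAssociated ξ W ∧ ∀ i, 1 ≤ i → W i ∈ Sset

/-- The matrix `(√2·a, 1; 1, 0)` attached to a letter `a`. -/
noncomputable def letterMat (a : ℕ) : Matrix (Fin 2) (Fin 2) ℝ := !![√2 * a, 1; 1, 0]

/-- The product of the matrices attached to the letters of a word. -/
noncomputable def wordMat (u : List ℕ) : Matrix (Fin 2) (Fin 2) ℝ := (u.map letterMat).prod

lemma wordMat_append (u v : List ℕ) : wordMat (u ++ v) = wordMat u * wordMat v := by
  simp [wordMat]

lemma transpose_letterMat (a : ℕ) : (letterMat a)ᵀ = letterMat a := by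
  ext i j; fin_cases i <;> fin_cases j <;> simp [letterMat]

lemma wordMat_reverse (u : List ℕ) : wordMat u.reverse = (wordMat u)ᵀ := by
  rw [wordMat, wordMat, Matrix.transpose_list_prod, List.map_map, List.map_reverse]
  congr 3
  ext1 a
  simp [transpose_letterMat]

/-- The two letters separating consecutive palindromic prefixes of the Fibonacci word. -/
def sep (n : ℕ) : List ℕ := if n % 2 = 0 then [2, 1] else [1, 2]

/-- The palindromic prefixes of the Fibonacci word on the letters `1` and `2`. -/
def palin : ℕ → List ℕ
  | 0 => []
  | 1 => [1]
  | n + 2 => palin (n + 1) ++ (sep n ++ palin n)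

lemma sep_add_two (n : ℕ) : sep (n + 2) = sep n := by simp [sep]

lemma sep_succ (n : ℕ) : sep (n + 1) = (sep n).reverse := by
  rcases Nat.mod_two_eq_zero_or_one n with h | h
  · have : (n + 1) % 2 = 1 := by omega
    simp [sep, h, this]
  · have : (n + 1) % 2 = 0 := by omega
    simp [sep, h, this]

lemma palin_add_two (n : ℕ) : palin (n + 2) = palin (n + 1) ++ (sep n ++ palin n) := by
  rw [palin]

lemma palin_add_two' (n : ℕ) : palin (n + 2) = palin n ++ (sep (n + 1) ++ palin (n + 1)) := by
  induction n with
  | zero => simp [palin, sep]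
  | succ n ih =>
    rw [palin_add_two (n + 1), sep_add_two]
    nth_rewrite 1 [palin_add_two]
    rw [ih]
    simp

lemma palin_reverse (n : ℕ) : (palin n).reverse = palin n := by
  induction n using Nat.twoStepInduction with
  | zero => simp [palin]
  | one => simp [palin]
  | more n h1 h2 =>
    rw [palin_add_two, List.reverse_append, List.reverse_append, h1, h2, ← sep_succ,
      ← palin_add_two, palin_add_two', List.append_assoc]

lemma palin_length_lt (n : ℕ) : n < (palin (n + 1)).length := by
  induction n with
  | zero => simp [palin]
  | succ n ih =>
    rw [palin_add_two, List.length_append]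
    have : (sep n).length = 2 := by unfold sep; split_ifs <;> simp
    rw [List.length_append]
    omega

lemma palin_length_add_two (n : ℕ) :
    (palin (n + 2)).length = (palin (n + 1)).length + (palin n).length + 2 := by
  have : (sep n).length = 2 := by unfold sep; split_ifs <;> simp
  rw [palin_add_two, List.length_append, List.length_append]
  omega

lemma palin_length_odd (n : ℕ) : (palin n).length % 2 = 1 ∨ (palin (n + 1)).length % 2 = 1 := by
  induction n with
  | zero => simp [palin]
  | succ n ih => rw [palin_length_add_two]; omega

lemma palin_prefix {i j : ℕ} (h : i ≤ j) : palin i <+: palin j := by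
  induction j, h using Nat.le_induction with
  | base => exact List.prefix_rfl
  | succ j _ ih =>
    refine ih.trans ?_
    cases j with
    | zero => simp [palin]
    | succ j => rw [palin_add_two]; exact List.prefix_append _ _

lemma palin_mem (n : ℕ) : ∀ a ∈ palin n, a = 1 ∨ a = 2 := by
  induction n using Nat.twoStepInduction with
  | zero => simp [palin]
  | one => simp [palin]
  | more n h1 h2 =>
    intro a ha
    rw [palin_add_two, List.mem_append, List.mem_append] at ha
    rcases ha with h | h | h
    · exact h2 a h
    · unfold sep at h
      split_ifs at h <;> simp at h <;> tauto
    · exact h1 a h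

/-- The `n`-th letter of the Fibonacci word. -/
def fibLetter (n : ℕ) : ℕ := (palin (n + 1)).getD n 1

lemma fibLetter_mem (n : ℕ) : fibLetter n = 1 ∨ fibLetter n = 2 := by
  unfold fibLetter
  rw [List.getD_eq_getElem _ _ (palin_length_lt n)]
  exact palin_mem _ _ (List.getElem_mem _)

lemma palin_getElem (i n : ℕ) (h : n < (palin i).length) : (palin i)[n] = fibLetter n := by
  unfold fibLetter
  rw [List.getD_eq_getElem _ _ (palin_length_lt n)]
  rw [(palin_prefix (le_max_left i (n + 1))).getElem h,
    (palin_prefix (le_max_right i (n + 1))).getElem]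

/-- The product of the matrices attached to the first `n` letters of the Fibonacci word. -/
noncomputable def prefixMat (n : ℕ) : Matrix (Fin 2) (Fin 2) ℝ :=
  wordMat ((List.range n).map fibLetter)

lemma prefixMat_length (i : ℕ) : prefixMat (palin i).length = wordMat (palin i) := by
  unfold prefixMat
  congr 1
  apply List.ext_getElem
  · simp
  · intro n h1 h2
    simp [palin_getElem i n h2]

lemma prefixMat_succ (n : ℕ) : prefixMat (n + 1) = prefixMat n * letterMat (fibLetter n) := by
  unfold prefixMat
  rw [List.range_succ, List.map_append, wordMat_append]
  simp [wordMat]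

lemma prefixMat_zero : prefixMat 0 = 1 := by simp [prefixMat, wordMat]

lemma prefixMat_palin_symm (i : ℕ) :
    prefixMat (palin i).length 1 0 = prefixMat (palin i).length 0 1 := by
  rw [prefixMat_length]
  have h := wordMat_reverse (palin i)
  rw [palin_reverse] at h
  conv_lhs => rw [h]
  rfl

lemma prefixMat_palin_add_two (i : ℕ) :
    prefixMat (palin (i + 2)).length = prefixMat (palin (i + 1)).length *
      (wordMat (sep i) * prefixMat (palin i).length) := by
  rw [prefixMat_length, prefixMat_length, prefixMat_length, palin_add_two, wordMat_append,
    wordMat_append]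

lemma wordMat_sep (i : ℕ) :
    wordMat (sep i) = !![5, 2 * √2; √2, 1] ∨ wordMat (sep i) = !![5, √2; 2 * √2, 1] := by
  have h : √2 * √2 = 2 := Real.mul_self_sqrt (by norm_num)
  unfold sep
  split_ifs
  · left
    simp [wordMat, letterMat]
    exact ⟨by linear_combination 2 * h, mul_comm _ _⟩
  · right
    simp [wordMat, letterMat]
    constructor <;> linarith

/-- Numerators of the convergents. -/
noncomputable def num (n : ℕ) : ℝ := prefixMat n 0 0

/-- Denominators of the convergents. -/
noncomputable def den (n : ℕ) : ℝ := prefixMat n 1 0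

lemma prefixMat_succ_apply_one (n : ℕ) (i : Fin 2) : prefixMat (n + 1) i 1 = prefixMat n i 0 := by
  rw [prefixMat_succ]; simp [letterMat, Matrix.mul_apply, Fin.sum_univ_two]

lemma prefixMat_succ_apply_zero (n : ℕ) (i : Fin 2) :
    prefixMat (n + 1) i 0 = √2 * fibLetter n * prefixMat n i 0 + prefixMat n i 1 := by
  rw [prefixMat_succ]; simp [letterMat, Matrix.mul_apply, Fin.sum_univ_two]; ring

lemma num_add_two (n : ℕ) : num (n + 2) = √2 * fibLetter (n + 1) * num (n + 1) + num n := by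
  simp only [num]
  rw [prefixMat_succ_apply_zero, prefixMat_succ_apply_one]

lemma den_add_two (n : ℕ) : den (n + 2) = √2 * fibLetter (n + 1) * den (n + 1) + den n := by
  simp only [den]
  rw [prefixMat_succ_apply_zero, prefixMat_succ_apply_one]

lemma fibLetter_bounds (n : ℕ) : 1.4 ≤ √2 * fibLetter n ∧ √2 * fibLetter n ≤ 3 := by
  have h1 : (1.4 : ℝ) ≤ √2 := Real.le_sqrt_of_sq_le (by norm_num)
  have h2 : √2 ≤ (1.5 : ℝ) := Real.sqrt_le_iff.2 (by norm_num)
  rcases fibLetter_mem n with h | h <;> rw [h] <;> push_cast <;> constructor <;> linarith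

lemma num_zero : num 0 = 1 := by simp [num, prefixMat_zero]
lemma den_zero : den 0 = 0 := by simp [den, prefixMat_zero]
lemma num_one : num 1 = √2 := by
  rw [num, prefixMat_succ_apply_zero]; simp [prefixMat_zero, fibLetter, palin]
lemma den_one : den 1 = 1 := by
  rw [den, prefixMat_succ_apply_zero]; simp [prefixMat_zero]

lemma prefixMat_det (n : ℕ) : |(prefixMat n).det| = 1 := by
  induction n with
  | zero => simp [prefixMat_zero]
  | succ n ih => rw [prefixMat_succ, Matrix.det_mul, abs_mul, ih]; simp [letterMat, Matrix.det_fin_two]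

lemma num_den_det (n : ℕ) : |num (n + 1) * den n - num n * den (n + 1)| = 1 := by
  have h := prefixMat_det (n + 1)
  rwa [Matrix.det_fin_two, prefixMat_succ_apply_one, prefixMat_succ_apply_one] at h

lemma den_bounds (n : ℕ) : 0 ≤ den n ∧ 1 ≤ den (n + 1) ∧ den n ≤ den (n + 1) := by
  induction n with
  | zero => simp [den_zero, den_one]
  | succ n ih =>
    obtain ⟨h1, h2, h3⟩ := ih
    have := (fibLetter_bounds (n + 1)).1
    have h4 : den (n + 1) ≤ den (n + 2) := by rw [den_add_two]; nlinarith
    exact ⟨by linarith, by linarith, h4⟩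

lemma num_bounds (n : ℕ) : 1 ≤ num n ∧ num n ≤ num (n + 1) := by
  induction n with
  | zero =>
    rw [num_zero, num_one]
    exact ⟨le_rfl, Real.le_sqrt_of_sq_le (by norm_num)⟩
  | succ n ih =>
    obtain ⟨h1, h2⟩ := ih
    have := (fibLetter_bounds (n + 1)).1
    refine ⟨by linarith, ?_⟩
    rw [num_add_two]; nlinarith

lemma den_le_num (n : ℕ) : den n ≤ num n ∧ den (n + 1) ≤ num (n + 1) := by
  induction n with
  | zero =>
    rw [num_zero, num_one, den_zero, den_one]
    exact ⟨by norm_num, Real.le_sqrt_of_sq_le (by norm_num)⟩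
  | succ n ih =>
    obtain ⟨h1, h2⟩ := ih
    have := (fibLetter_bounds (n + 1)).1
    refine ⟨h2, ?_⟩
    rw [num_add_two, den_add_two]; nlinarith

lemma num_le_den (n : ℕ) : num (n + 1) ≤ 3 * den (n + 1) ∧ num (n + 2) ≤ 3 * den (n + 2) := by
  have hs : √2 * √2 = 2 := Real.mul_self_sqrt (by norm_num)
  have h1 : (1.4 : ℝ) ≤ √2 := Real.le_sqrt_of_sq_le (by norm_num)
  have h2 : √2 ≤ (1.5 : ℝ) := Real.sqrt_le_iff.2 (by norm_num)
  induction n with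
  | zero =>
    simp only [zero_add, num_add_two, den_add_two 0, num_one, den_one, num_zero, den_zero]
    have := (fibLetter_bounds 1).1
    exact ⟨by linarith, by nlinarith⟩
  | succ n ih =>
    obtain ⟨h1, h2⟩ := ih
    have := (fibLetter_bounds (n + 2)).1
    refine ⟨h2, ?_⟩
    rw [num_add_two (n + 1), den_add_two (n + 1)]; nlinarith

lemma den_growth (n : ℕ) : (1.4 : ℝ) ^ n ≤ den (n + 1) := by
  induction n with
  | zero => simp [den_one]
  | succ n ih =>
    have := (fibLetter_bounds (n + 1)).1
    have := den_bounds n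
    rw [pow_succ, den_add_two]; nlinarith

open Filter Topology in
/-- A sequence whose steps are bounded by the decrements of a sequence tending to `0` converges,
with the corresponding error bound. -/
lemma exists_limit_of_step_le (f e : ℕ → ℝ) (he0 : ∀ n, 0 ≤ e n) (he : Tendsto e atTop (𝓝 0))
    (h : ∀ n, |f (n + 1) - f n| ≤ e n - e (n + 1)) : ∃ L, ∀ n, |L - f n| ≤ e n := by
  have key : ∀ n k, |f (n + k) - f n| ≤ e n - e (n + k) := by
    intro n k
    induction k with
    | zero => simp
    | succ k ih =>
      have := abs_add_le (f (n + (k + 1)) - f (n + k)) (f (n + k) - f n)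
      have h2 := h (n + k)
      rw [sub_add_sub_cancel] at this
      rw [← add_assoc] at this ⊢
      linarith
  have hc : CauchySeq f := by
    refine cauchySeq_of_le_tendsto_0 (fun n => 2 * e n) ?_ (by simpa using he.const_mul 2)
    intro n m N hn hm
    obtain ⟨a, rfl⟩ := Nat.exists_eq_add_of_le hn
    obtain ⟨b, rfl⟩ := Nat.exists_eq_add_of_le hm
    rw [Real.dist_eq]
    have h1 := abs_le.1 (key N a)
    have h2 := abs_le.1 (key N b)
    have := he0 (N + a)
    have := he0 (N + b)
    rw [abs_le]
    constructor <;> linarith [h1.1, h1.2, h2.1, h2.2]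
  obtain ⟨L, hL⟩ := cauchySeq_tendsto_of_complete hc
  refine ⟨L, fun n => ?_⟩
  have h1 : Tendsto (fun m => |f m - f n|) atTop (𝓝 |L - f n|) := (hL.sub_const _).abs
  refine le_of_tendsto h1 ?_
  filter_upwards [eventually_ge_atTop n] with m hm
  obtain ⟨a, rfl⟩ := Nat.exists_eq_add_of_le hm
  linarith [key n a, he0 (n + a)]

open Filter Topology in
lemma den_tendsto : Tendsto den atTop atTop := by
  rw [← tendsto_add_atTop_iff_nat 1]
  exact tendsto_atTop_mono den_growth (tendsto_pow_atTop_atTop_of_one_lt (by norm_num))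

open Filter Topology in
lemma exists_cf_limit : ∃ θ : ℝ, ∀ n, |den n * θ - num n| ≤ 2 / den (n + 1) := by
  have hpos : ∀ n, 0 < den (n + 1) := fun n => by linarith [(den_bounds n).2.1]
  obtain ⟨θ, hθ⟩ := exists_limit_of_step_le (fun n => num (n + 1) / den (n + 1))
    (fun n => 2 / (den (n + 1) * den (n + 2)))
    (fun n => by have := hpos n; have := hpos (n + 1); positivity)
    (by
      refine Tendsto.div_atTop tendsto_const_nhds ?_
      exact ((tendsto_add_atTop_iff_nat 1).2 den_tendsto).atTop_mul_atTop₀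
        ((tendsto_add_atTop_iff_nat 2).2 den_tendsto))
    (by
      intro n
      have h1 := hpos n
      have h2 : 0 < den (n + 2) := hpos (n + 1)
      have h3 : 0 < den (n + 3) := hpos (n + 2)
      have hd : |num (n + 2) * den (n + 1) - num (n + 1) * den (n + 2)| = 1 := num_den_det (n + 1)
      have h4 : 2 * den (n + 1) ≤ den (n + 3) := by
        have : den (n + 3) = √2 * fibLetter (n + 2) * den (n + 2) + den (n + 1) :=
          den_add_two (n + 1)
        have h5 := (fibLetter_bounds (n + 2)).1
        have : den (n + 1) ≤ den (n + 2) := (den_bounds (n + 1)).2.2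
        nlinarith
      show |num (n + 2) / den (n + 2) - num (n + 1) / den (n + 1)| ≤
        2 / (den (n + 1) * den (n + 2)) - 2 / (den (n + 2) * den (n + 3))
      rw [div_sub_div _ _ h2.ne' h1.ne', abs_div,
        show num (n + 2) * den (n + 1) - den (n + 2) * num (n + 1)
          = num (n + 2) * den (n + 1) - num (n + 1) * den (n + 2) by ring, hd,
        abs_of_pos (mul_pos h2 h1)]
      have h6 : 2 / (den (n + 2) * den (n + 3)) ≤ 1 / (den (n + 2) * den (n + 1)) := by
        rw [div_le_div_iff₀ (by positivity) (by positivity)]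
        nlinarith
      have h7 : 2 / (den (n + 1) * den (n + 2)) = 2 * (1 / (den (n + 2) * den (n + 1))) := by
        rw [mul_comm (den (n + 1))]; ring
      linarith)
  refine ⟨θ, fun n => ?_⟩
  cases n with
  | zero =>
    simp [den_zero, num_zero, den_one]
  | succ n =>
    have h1 := hpos n
    have h2 : 0 < den (n + 2) := hpos (n + 1)
    have h : |θ - num (n + 1) / den (n + 1)| ≤ 2 / (den (n + 1) * den (n + 2)) := hθ n
    have e : den (n + 1) * θ - num (n + 1) = den (n + 1) * (θ - num (n + 1) / den (n + 1)) := by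
      field_simp
    rw [e, abs_mul, abs_of_pos h1]
    calc den (n + 1) * |θ - num (n + 1) / den (n + 1)|
        ≤ den (n + 1) * (2 / (den (n + 1) * den (n + 2))) := by gcongr
      _ = 2 / den (n + 2) := by field_simp

lemma prefixMat_int (k : ℕ) :
    (∃ a b c d : ℤ, prefixMat (2 * k) = !![(a : ℝ), √2 * b; √2 * c, d]) ∧
    ∃ a b c d : ℤ, prefixMat (2 * k + 1) = !![√2 * a, (b : ℝ); c, √2 * d] := by
  have hs : √2 * √2 = 2 := Real.mul_self_sqrt (by norm_num)
  have step1 : ∀ n, (∃ a b c d : ℤ, prefixMat n = !![(a : ℝ), √2 * b; √2 * c, d]) →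
      ∃ a b c d : ℤ, prefixMat (n + 1) = !![√2 * a, (b : ℝ); c, √2 * d] := by
    rintro n ⟨a, b, c, d, h⟩
    refine ⟨a * fibLetter n + b, a, 2 * c * fibLetter n + d, c, ?_⟩
    rw [prefixMat_succ, h, letterMat, Matrix.mul_fin_two]
    push_cast
    ext i j
    fin_cases i <;> fin_cases j <;> simp
    · ring
    · linear_combination (c : ℝ) * fibLetter n * hs
  have step2 : ∀ n, (∃ a b c d : ℤ, prefixMat n = !![√2 * a, (b : ℝ); c, √2 * d]) →
      ∃ a b c d : ℤ, prefixMat (n + 1) = !![(a : ℝ), √2 * b; √2 * c, d] := by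
    rintro n ⟨a, b, c, d, h⟩
    refine ⟨2 * a * fibLetter n + b, a, c * fibLetter n + d, c, ?_⟩
    rw [prefixMat_succ, h, letterMat, Matrix.mul_fin_two]
    push_cast
    ext i j
    fin_cases i <;> fin_cases j <;> simp
    · linear_combination (a : ℝ) * fibLetter n * hs
    · ring
  have h0 : ∃ a b c d : ℤ, prefixMat (2 * k) = !![(a : ℝ), √2 * b; √2 * c, d] := by
    induction k with
    | zero => exact ⟨1, 0, 0, 1, by simp [prefixMat_zero, Matrix.one_fin_two]⟩
    | succ k ih => exact step2 _ (step1 _ ih)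
  exact ⟨h0, step1 _ h0⟩

/-- The pairing of the convergents with an integer point `(P, Q)` takes values in a discrete set. -/
lemma pairing_discrete (n : ℕ) (P Q : ℤ) :
    den n * (√2 * P) - num n * Q = 0 ∨ 1 ≤ |den n * (√2 * P) - num n * Q| := by
  have hs : √2 * √2 = 2 := Real.mul_self_sqrt (by norm_num)
  have h1 : (1 : ℝ) ≤ √2 := Real.le_sqrt_of_sq_le (by norm_num)
  have int_case : ∀ m : ℤ, (m : ℝ) = 0 ∨ 1 ≤ |(m : ℝ)| := by
    intro m
    by_cases h : m = 0
    · left; simp [h]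
    · right; exact_mod_cast Int.one_le_abs h
  rcases Nat.even_or_odd' n with ⟨k, rfl | rfl⟩
  · obtain ⟨a, b, c, d, h⟩ := (prefixMat_int k).1
    have e : den (2 * k) * (√2 * P) - num (2 * k) * Q = ((2 * c * P - a * Q : ℤ) : ℝ) := by
      simp only [den, num, h]
      push_cast
      simp
      linear_combination (c : ℝ) * P * hs
    rw [e]
    exact int_case _
  · obtain ⟨a, b, c, d, h⟩ := (prefixMat_int k).2
    have e : den (2 * k + 1) * (√2 * P) - num (2 * k + 1) * Q
        = √2 * ((c * P - a * Q : ℤ) : ℝ) := by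
      simp only [den, num, h]
      push_cast
      simp
      ring
    rw [e]
    rcases int_case (c * P - a * Q) with h | h
    · left; rw [h, mul_zero]
    · right; rw [abs_mul, abs_of_nonneg (by linarith)]; nlinarith

lemma cf_limit_lower (θ : ℝ) (hθ : ∀ n, |den n * θ - num n| ≤ 2 / den (n + 1)) (P Q : ℤ)
    (hQ : Q ≠ 0) : 1 ≤ 34 * (|(Q : ℝ)| * |Q * θ - √2 * P|) := by
  have hQ1 : (1 : ℝ) ≤ |(Q : ℝ)| := by exact_mod_cast Int.one_le_abs hQ
  have bound : ∀ n, den n * (√2 * P) - num n * Q ≠ 0 → 4 * |(Q : ℝ)| ≤ den (n + 1) →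
      1 ≤ 2 * (den n * |Q * θ - √2 * P|) := by
    intro n hn hle
    have h1 := (pairing_discrete n P Q).resolve_left hn
    have h2 : |den n * (√2 * P) - num n * Q| ≤
        |(Q : ℝ)| * |den n * θ - num n| + den n * |Q * θ - √2 * P| := by
      have e : den n * (√2 * P) - num n * Q
        = Q * (den n * θ - num n) - den n * (Q * θ - √2 * P) := by ring
      rw [e]
      refine (abs_sub _ _).trans ?_
      rw [abs_mul, abs_mul, abs_of_nonneg (den_bounds n).1]
    have h3 : |(Q : ℝ)| * |den n * θ - num n| ≤ 1 / 2 := by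
      have hp : 0 < den (n + 1) := by linarith
      calc |(Q : ℝ)| * |den n * θ - num n| ≤ |(Q : ℝ)| * (2 / den (n + 1)) := by
            gcongr; exact hθ n
        _ ≤ 1 / 2 := by
            rw [mul_div_assoc', div_le_div_iff₀ hp (by norm_num)]; linarith
    linarith
  have hex : ∃ n, 4 * |(Q : ℝ)| ≤ den n := (den_tendsto.eventually_ge_atTop _).exists
  classical
  obtain ⟨m, hm⟩ : ∃ m, Nat.find hex = m + 1 := by
    refine Nat.exists_eq_succ_of_ne_zero fun h0 => ?_
    have := Nat.find_spec hex
    rw [h0, den_zero] at this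
    linarith
  have hup : 4 * |(Q : ℝ)| ≤ den (m + 1) := hm ▸ Nat.find_spec hex
  have hlow : den m < 4 * |(Q : ℝ)| := not_le.1 (Nat.find_min hex (by omega))
  have hδ := abs_nonneg ((Q : ℝ) * θ - √2 * P)
  have hm0 := (den_bounds m).1
  by_cases hz : den m * (√2 * P) - num m * Q = 0
  · have hz' : den (m + 1) * (√2 * P) - num (m + 1) * Q ≠ 0 := by
      intro h
      have hd := num_den_det m
      have : (num (m + 1) * den m - num m * den (m + 1)) * Q = 0 := by
        linear_combination den (m + 1) * hz - den m * h
      rcases mul_eq_zero.1 this with h' | h'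
      · rw [h'] at hd; simp at hd
      · exact hQ (by exact_mod_cast h')
    have h1 := bound (m + 1) hz' (hup.trans (den_bounds (m + 1)).2.2)
    have h2 : den (m + 1) ≤ 4 * den m + 1 := by
      cases m with
      | zero => simp [den_one, den_zero]
      | succ m =>
        have := (fibLetter_bounds (m + 1)).2
        have := (den_bounds m)
        rw [den_add_two]; nlinarith
    have : den (m + 1) * |Q * θ - √2 * P| ≤ 17 * |(Q : ℝ)| * |Q * θ - √2 * P| := by
      gcongr; linarith
    linarith
  · have h1 := bound m hz hup
    have : den m * |Q * θ - √2 * P| ≤ 4 * |(Q : ℝ)| * |Q * θ - √2 * P| := by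
      gcongr
    have : 0 ≤ |(Q : ℝ)| * |Q * θ - √2 * P| := by positivity
    linarith

/-- The determinant of three integer points. -/
def det3 (x y z : Fin 3 → ℤ) : ℤ :=
  x 0 * (y 1 * z 2 - y 2 * z 1) - x 1 * (y 0 * z 2 - y 2 * z 0) + x 2 * (y 0 * z 1 - y 1 * z 0)

/-- The determinant of an integer point seen as a symmetric matrix. -/
def disc (x : Fin 3 → ℤ) : ℤ := x 0 * x 2 - x 1 ^ 2

/-- The integer point `x` has size at most `C * exp t` and approximates `(1, ξ, ξ ^ 2)`
up to `C * exp (-t)`. -/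
structure ApproxPoint (ξ C t : ℝ) (x : Fin 3 → ℤ) : Prop where
  size : ∀ k, |(x k : ℝ)| ≤ C * Real.exp t
  fst : |(x 0 : ℝ) * ξ - x 1| ≤ C * Real.exp (-t)
  snd : |(x 1 : ℝ) * ξ - x 2| ≤ C * Real.exp (-t)

lemma exists_scaled_point (n : ℕ) : ∃ (x : Fin 3 → ℤ) (κ : ℝ), 0 < κ ∧ κ ≤ 1 ∧
    (n % 2 = 0 ∧ 2 * κ ^ 2 = 2 ∨ n % 2 = 1 ∧ 2 * κ ^ 2 = 1) ∧
    (x 0 : ℝ) = κ * (2 * prefixMat n 1 1) ∧ (x 1 : ℝ) = κ * (√2 * prefixMat n 0 1) ∧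
    (x 2 : ℝ) = κ * prefixMat n 0 0 := by
  have hs : √2 * √2 = 2 := Real.mul_self_sqrt (by norm_num)
  have h2 : √2 ≤ (1.5 : ℝ) := Real.sqrt_le_iff.2 (by norm_num)
  have h0 : 0 < √2 := by positivity
  rcases Nat.even_or_odd' n with ⟨k, rfl | rfl⟩
  · obtain ⟨a, b, c, d, h⟩ := (prefixMat_int k).1
    refine ⟨![2 * d, 2 * b, a], 1, one_pos, le_rfl, Or.inl ⟨by omega, by norm_num⟩, ?_, ?_, ?_⟩ <;>
      simp [h]
    linear_combination -(b : ℝ) * hs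
  · obtain ⟨a, b, c, d, h⟩ := (prefixMat_int k).2
    refine ⟨![2 * d, b, a], √2 / 2, by positivity, by linarith, Or.inr ⟨by omega, ?_⟩, ?_, ?_, ?_⟩
    · linear_combination hs / 2
    all_goals simp [h]
    · linear_combination -(d : ℝ) * hs
    · linear_combination -(b : ℝ) / 2 * hs
    · linear_combination -(a : ℝ) / 2 * hs

lemma prefixMat_nonneg_le (n : ℕ) (i j : Fin 2) :
    0 ≤ prefixMat n i j ∧ prefixMat n i j ≤ num n := by
  have key : ∀ n (i : Fin 2), 0 ≤ prefixMat n i 0 ∧ prefixMat n i 0 ≤ num n := by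
    intro n i
    have h1 := (num_bounds n).1
    have h2 := den_bounds n
    have h3 := den_le_num n
    fin_cases i
    · exact ⟨by show 0 ≤ num n; linarith, le_rfl⟩
    · exact ⟨h2.1, h3.1⟩
  fin_cases j
  · exact key n i
  · cases n with
    | zero => fin_cases i <;> simp [prefixMat_zero, num_zero]
    | succ n =>
      have := prefixMat_succ_apply_one n i
      have h1 := (num_bounds n).2
      obtain ⟨h2, h3⟩ := key n i
      show 0 ≤ prefixMat (n + 1) i 1 ∧ prefixMat (n + 1) i 1 ≤ num (n + 1)
      rw [this]
      exact ⟨h2, h3.trans h1⟩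

lemma num_palin_add_two (i : ℕ) :
    num (palin (i + 1)).length * num (palin i).length ≤ num (palin (i + 2)).length ∧
    num (palin (i + 2)).length ≤ 12 * (num (palin (i + 1)).length * num (palin i).length) := by
  have h2 : √2 ≤ (1.5 : ℝ) := Real.sqrt_le_iff.2 (by norm_num)
  have h0 : 0 < √2 := by positivity
  have hp := (num_bounds (palin i).length).1
  have hp' := (num_bounds (palin (i + 1)).length).1
  obtain ⟨ha, ha'⟩ := prefixMat_nonneg_le (palin (i + 1)).length 0 1
  obtain ⟨hb, hb'⟩ := prefixMat_nonneg_le (palin i).length 1 0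
  have e : num (palin (i + 2)).length = num (palin (i + 1)).length *
      (wordMat (sep i) 0 0 * num (palin i).length
        + wordMat (sep i) 0 1 * prefixMat (palin i).length 1 0) +
      prefixMat (palin (i + 1)).length 0 1 *
      (wordMat (sep i) 1 0 * num (palin i).length
        + wordMat (sep i) 1 1 * prefixMat (palin i).length 1 0) := by
    conv_lhs => rw [num, prefixMat_palin_add_two]
    simp only [Matrix.mul_apply, Fin.sum_univ_two, num]
  generalize num (palin i).length = p at *
  generalize num (palin (i + 1)).length = P at *
  generalize prefixMat (palin (i + 1)).length 0 1 = Q at *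
  generalize prefixMat (palin i).length 1 0 = q at *
  have e1 : P * q ≤ P * p := by gcongr
  have e2 : Q * p ≤ P * p := by gcongr
  have e3 : Q * q ≤ P * p := by gcongr
  have e1' : 0 ≤ P * q := by positivity
  have e2' : 0 ≤ Q * p := by positivity
  have e3' : 0 ≤ Q * q := by positivity
  have e4' : 0 ≤ P * p := by positivity
  have f1 : √2 * (P * q) ≤ 1.5 * (P * p) := by gcongr
  have f2 : √2 * (Q * p) ≤ 1.5 * (P * p) := by gcongr
  have f1' : 0 ≤ √2 * (P * q) := by positivity
  have f2' : 0 ≤ √2 * (Q * p) := by positivity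
  rcases wordMat_sep i with h | h <;> rw [h] at e <;> simp at e <;> rw [e] <;>
    constructor <;> nlinarith

lemma det_symm_product (i : ℕ) :
    let S := prefixMat (palin i).length
    let S' := prefixMat (palin (i + 1)).length
    let S'' := prefixMat (palin (i + 2)).length
    S 1 1 * (S' 0 1 * S'' 0 0 - S' 0 0 * S'' 0 1) - S 0 1 * (S' 1 1 * S'' 0 0 - S' 0 0 * S'' 1 1)
      + S 0 0 * (S' 1 1 * S'' 0 1 - S' 0 1 * S'' 1 1) ≠ 0 := by
  intro S S' S''
  have h0 : 0 < √2 := by positivity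
  have hS : S 1 0 = S 0 1 := prefixMat_palin_symm i
  have hS' : S' 1 0 = S' 0 1 := prefixMat_palin_symm (i + 1)
  have hS'' : S'' 1 0 = S'' 0 1 := prefixMat_palin_symm (i + 2)
  have hdS : |S.det| = 1 := prefixMat_det _
  have hdS' : |S'.det| = 1 := prefixMat_det _
  set T := wordMat (sep i) with hT
  have hprod : S'' = S' * (T * S) := prefixMat_palin_add_two i
  have hT' : T 0 1 - T 1 0 ≠ 0 := by
    rcases wordMat_sep i with h | h <;> rw [hT, h] <;> simp
    · intro h; linarith
    · intro h; linarith
  have key : S 1 1 * (S' 0 1 * S'' 0 0 - S' 0 0 * S'' 0 1)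
      - S 0 1 * (S' 1 1 * S'' 0 0 - S' 0 0 * S'' 1 1)
      + S 0 0 * (S' 1 1 * S'' 0 1 - S' 0 1 * S'' 1 1) = S.det * S'.det * (T 0 1 - T 1 0) := by
    have h01 : S'' 0 1 = S'' 1 0 := hS''.symm
    rw [hprod] at h01 ⊢
    simp only [Matrix.mul_apply, Fin.sum_univ_two, Matrix.det_fin_two, hS, hS'] at h01 ⊢
    linear_combination (S 0 1 * S' 0 1 - S 1 1 * S' 0 0) * h01
  rw [key]
  refine mul_ne_zero (mul_ne_zero ?_ ?_) hT'
  · intro h; rw [h] at hdS; simp at hdS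
  · intro h; rw [h] at hdS'; simp at hdS'

/-- The sequence of points attached to the palindromic prefixes of the Fibonacci word. -/
lemma exists_fib_points (θ : ℝ) (hθ : ∀ n, |den n * θ - num n| ≤ 2 / den (n + 1)) :
    ∃ (l : ℕ → ℝ) (x : ℕ → Fin 3 → ℤ), (∀ i, ApproxPoint (θ / √2) 12 (l i) (x i)) ∧ 0 < l 0 ∧ 0 < l 1 ∧
      (∀ i, l (i + 1) + l i ≤ l (i + 2) ∧ l (i + 2) ≤ l (i + 1) + l i + Real.log 12) ∧
      (∀ i, det3 (x i) (x (i + 1)) (x (i + 2)) ≠ 0) ∧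
      ∀ i, ∃ j ≤ 2, ∃ k ≤ 2, |disc (x (i + j))| = 1 ∧ |disc (x (i + k))| = 2 := by
  have hs : √2 * √2 = 2 := Real.mul_self_sqrt (by norm_num)
  have hs2 : √2 ≤ (1.5 : ℝ) := Real.sqrt_le_iff.2 (by norm_num)
  have hs1 : 1 < √2 := Real.lt_sqrt_of_sq_lt (by norm_num)
  choose x κ hκ0 hκ1 hκ hx0 hx1 hx2 using fun i => exists_scaled_point (palin (i + 1)).length
  have hpos : ∀ n, 0 < num n := fun n => by linarith [(num_bounds n).1]
  have hnum1 : num (palin 1).length = √2 := by simpa [palin] using num_one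
  have hlen : ∀ i, ∃ m, (palin (i + 1)).length = m + 1 := fun i =>
    Nat.exists_eq_succ_of_ne_zero (by have := palin_length_lt i; omega)
  have hdisc : ∀ i, ((palin (i + 1)).length % 2 = 0 → |disc (x i)| = 2) ∧
      ((palin (i + 1)).length % 2 = 1 → |disc (x i)| = 1) := by
    intro i
    have e : (disc (x i) : ℝ) = 2 * κ i ^ 2 * (prefixMat (palin (i + 1)).length).det := by
      rw [disc, Matrix.det_fin_two]
      push_cast
      rw [hx0, hx1, hx2, prefixMat_palin_symm]
      linear_combination -(κ i * prefixMat (palin (i + 1)).length 0 1) ^ 2 * hs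
    have e2 : |(disc (x i) : ℝ)| = 2 * κ i ^ 2 := by
      rw [e, abs_mul, prefixMat_det, mul_one, abs_of_nonneg (by positivity)]
    rcases hκ i with ⟨h1, h2⟩ | ⟨h1, h2⟩ <;> rw [h2] at e2 <;> constructor <;> intro h
    · exact_mod_cast e2
    · omega
    · omega
    · exact_mod_cast e2
  refine ⟨fun i => Real.log (num (palin (i + 1)).length), x, fun i => ⟨?_, ?_, ?_⟩,
    ?_, ?_, ?_, ?_, ?_⟩
  · intro k
    rw [Real.exp_log (hpos _)]
    have hp := hpos (palin (i + 1)).length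
    have a1 := prefixMat_nonneg_le (palin (i + 1)).length 1 1
    have a2 := prefixMat_nonneg_le (palin (i + 1)).length 0 1
    have a3 := prefixMat_nonneg_le (palin (i + 1)).length 0 0
    have h0 := hκ0 i
    have h1 := hκ1 i
    fin_cases k
    · show |(x i 0 : ℝ)| ≤ _
      rw [hx0, abs_of_nonneg (mul_nonneg h0.le (by linarith))]
      nlinarith
    · show |(x i 1 : ℝ)| ≤ _
      rw [hx1, abs_of_nonneg (mul_nonneg h0.le (mul_nonneg (by linarith) a2.1))]
      nlinarith [mul_nonneg (by linarith : 0 ≤ √2) a2.1]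
    · show |(x i 2 : ℝ)| ≤ _
      rw [hx2, abs_of_nonneg (mul_nonneg h0.le a3.1)]
      nlinarith
  · rw [Real.exp_neg, Real.exp_log (hpos _)]
    obtain ⟨m, hm⟩ := hlen i
    have e : (x i 0 : ℝ) * (θ / √2) - x i 1 = κ i * √2 * (den m * θ - num m) := by
      rw [hx0, hx1, hm, prefixMat_succ_apply_one, prefixMat_succ_apply_one, den, num]
      field_simp
      linear_combination -κ i * θ * prefixMat m 1 0 * hs
    have hd : 0 < den (m + 1) := by linarith [(den_bounds m).2.1]
    have hn := (num_le_den m).1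
    rw [e, abs_mul, hm, abs_of_nonneg (mul_nonneg (hκ0 i).le (by linarith))]
    have h1 : κ i * √2 ≤ 1.5 := by nlinarith [hκ0 i, hκ1 i]
    calc κ i * √2 * |den m * θ - num m| ≤ 1.5 * (2 / den (m + 1)) := by
          gcongr; exact hθ m
      _ ≤ 12 * (num (m + 1))⁻¹ := by
          have := hpos (m + 1)
          rw [← div_eq_mul_inv, ← mul_div_assoc, div_le_div_iff₀ hd this]
          linarith
  · rw [Real.exp_neg, Real.exp_log (hpos _)]
    obtain ⟨m, hm⟩ := hlen i
    have e : (x i 1 : ℝ) * (θ / √2) - x i 2 = κ i * (den (m + 1) * θ - num (m + 1)) := by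
      rw [hx1, hx2, ← prefixMat_palin_symm, hm, den, num]
      field_simp
    have hd : 0 < den (m + 2) := by linarith [(den_bounds (m + 1)).2.1]
    have hd1 : 0 < den (m + 1) := by linarith [(den_bounds m).2.1]
    have hd2 := (den_bounds (m + 1)).2.2
    have hn := (num_le_den m).1
    rw [e, abs_mul, hm, abs_of_nonneg (hκ0 i).le]
    calc κ i * |den (m + 1) * θ - num (m + 1)| ≤ 1 * (2 / den (m + 2)) := by
          gcongr
          · exact hκ1 i
          · exact hθ (m + 1)
      _ ≤ 12 * (num (m + 1))⁻¹ := by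
          have := hpos (m + 1)
          rw [← div_eq_mul_inv, ← mul_div_assoc, div_le_div_iff₀ hd this]
          linarith
  · show 0 < Real.log (num (palin 1).length)
    rw [hnum1]; exact Real.log_pos hs1
  · show 0 < Real.log (num (palin 2).length)
    have h := (num_palin_add_two 0).1
    refine Real.log_pos (lt_of_lt_of_le ?_ h)
    have : num (palin 0).length = 1 := by simpa [palin] using num_zero
    simp only [zero_add]
    rw [hnum1, this]
    linarith
  · intro i
    obtain ⟨h1, h2⟩ := num_palin_add_two (i + 1)
    have p1 := hpos (palin (i + 1)).length
    have p2 := hpos (palin (i + 2)).length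
    constructor
    · show Real.log (num (palin (i + 2)).length) + _ ≤ _
      rw [← Real.log_mul p2.ne' p1.ne']
      exact Real.log_le_log (mul_pos p2 p1) h1
    · show _ ≤ Real.log (num (palin (i + 2)).length) + _ + _
      rw [← Real.log_mul p2.ne' p1.ne', ← Real.log_mul (mul_pos p2 p1).ne' (by norm_num),
        mul_comm _ (12 : ℝ)]
      exact Real.log_le_log (hpos _) h2
  · intro i h
    refine det_symm_product (i + 1) ?_
    have h' : ((det3 (x i) (x (i + 1)) (x (i + 2)) : ℤ) : ℝ) = 0 := by exact_mod_cast h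
    rw [det3] at h'
    push_cast at h'
    simp only [hx0, hx1, hx2] at h'
    have hne : κ i * κ (i + 1) * κ (i + 2) * (2 * √2) ≠ 0 := by
      have := hκ0 i; have := hκ0 (i + 1); have := hκ0 (i + 2); positivity
    refine (mul_eq_zero.1 ?_).resolve_left hne
    linear_combination h'
  · intro i
    have h2 : (palin (i + 2 + 1)).length = _ := palin_length_add_two (i + 1)
    have h0 := palin_length_odd (i + 1)
    have d0 := hdisc i
    have d1 := hdisc (i + 1)
    have d2 := hdisc (i + 2)
    rcases Nat.mod_two_eq_zero_or_one (palin (i + 1)).length with a | a <;>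
      rcases Nat.mod_two_eq_zero_or_one (palin (i + 1 + 1)).length with b | b
    · omega
    · exact ⟨1, by norm_num, 0, by norm_num, d1.2 b, d0.1 a⟩
    · exact ⟨0, by norm_num, 1, by norm_num, d0.2 a, d1.1 b⟩
    · exact ⟨0, by norm_num, 2, by norm_num, d0.2 a, d2.1 (by omega)⟩

lemma ApproxPoint.mono {ξ C C' t : ℝ} {x : Fin 3 → ℤ} (h : ApproxPoint ξ C t x) (hC : C ≤ C') :
    ApproxPoint ξ C' t x :=
  ⟨fun k => (h.size k).trans (by gcongr), h.fst.trans (by gcongr), h.snd.trans (by gcongr)⟩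

lemma gam_sq : gam ^ 2 = gam + 1 := by
  have h : √5 * √5 = 5 := Real.mul_self_sqrt (by norm_num)
  rw [gam]; linear_combination h / 4

lemma gam_bounds : 1.61 < gam ∧ gam < 1.62 := by
  have h1 : (2.23 : ℝ) < √5 := Real.lt_sqrt_of_sq_lt (by norm_num)
  have h2 : √5 < (2.24 : ℝ) := (Real.sqrt_lt' (by norm_num)).2 (by norm_num)
  rw [gam]; constructor <;> linarith

lemma exists_golden_bound (l : ℕ → ℝ) (b : ℝ)
    (h : ∀ i, l (i + 1) + l i ≤ l (i + 2) ∧ l (i + 2) ≤ l (i + 1) + l i + b) :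
    ∃ B, 0 ≤ B ∧ ∀ i, |l (i + 1) - gam * l i| ≤ B := by
  obtain ⟨g1, g2⟩ := gam_bounds
  have hb : 0 ≤ b := by linarith [h 0]
  refine ⟨max |l 1 - gam * l 0| (3 * b), (abs_nonneg _).trans (le_max_left _ _), fun i => ?_⟩
  set D := max |l 1 - gam * l 0| (3 * b) with hD
  have hD3 : 3 * b ≤ D := le_max_right _ _
  induction i with
  | zero => exact le_max_left _ _
  | succ i ih =>
    have e : l (i + 2) - gam * l (i + 1) =
        (l (i + 2) - l (i + 1) - l i) + (1 - gam) * (l (i + 1) - gam * l i) := by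
      linear_combination -(l i) * gam_sq
    show |l (i + 2) - gam * l (i + 1)| ≤ D
    rw [e]
    refine (abs_add_le _ _).trans ?_
    rw [abs_mul, abs_of_nonneg (by linarith [(h i).1] : 0 ≤ l (i + 2) - l (i + 1) - l i),
      abs_of_nonpos (by linarith : 1 - gam ≤ 0)]
    have : -(1 - gam) * |l (i + 1) - gam * l i| ≤ 0.62 * D := by
      gcongr; linarith
    linarith [(h i).2]

lemma linear_growth (l : ℕ → ℝ) (h0 : 0 < l 0) (h1 : 0 < l 1)
    (h : ∀ i, l (i + 1) + l i ≤ l (i + 2)) : ∃ m > 0, ∀ i : ℕ, m * (i + 1) ≤ l i := by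
  refine ⟨min (l 0) (l 1 / 2), lt_min h0 (by linarith), fun i => ?_⟩
  set m := min (l 0) (l 1 / 2)
  have hm : 0 < m := lt_min h0 (by linarith)
  have e0 : m ≤ l 0 := min_le_left _ _
  have e1 : m ≤ l 1 / 2 := min_le_right _ _
  have key : ∀ i : ℕ, m * (i + 1) ≤ l i ∧ m * (i + 2) ≤ l (i + 1) := by
    intro i
    induction i with
    | zero => constructor <;> push_cast <;> linarith
    | succ i ih =>
      have : 0 ≤ m * i := by positivity
      refine ⟨by push_cast; linarith [ih.2], ?_⟩
      push_cast
      have := h i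
      show _ ≤ l (i + 2)
      linarith [ih.1, ih.2]
  exact (key i).1

lemma det3_eq_zero {ξ C r s t : ℝ} {x y z : Fin 3 → ℤ} (hC : 0 < C) (hx : ApproxPoint ξ C r x)
    (hy : ApproxPoint ξ C s y) (hz : ApproxPoint ξ C t z)
    (h1 : r - s - t ≤ -(6 * C ^ 3)) (h2 : s - r - t ≤ -(6 * C ^ 3))
    (h3 : t - r - s ≤ -(6 * C ^ 3)) : det3 x y z = 0 := by
  have term : ∀ (a b c u v w : ℝ), |a| ≤ C * Real.exp u → |b| ≤ C * Real.exp (-v) →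
      |c| ≤ C * Real.exp (-w) → u - v - w ≤ -(6 * C ^ 3) →
      |a * b * c| ≤ C ^ 3 * Real.exp (-(6 * C ^ 3)) := by
    intro a b c u v w ha hb hc h
    rw [abs_mul, abs_mul]
    calc |a| * |b| * |c| ≤ (C * Real.exp u) * (C * Real.exp (-v)) * (C * Real.exp (-w)) := by
          gcongr
      _ = C ^ 3 * Real.exp (u - v - w) := by
          rw [sub_eq_add_neg, sub_eq_add_neg, Real.exp_add, Real.exp_add]; ring
      _ ≤ _ := by gcongr
  have t1 := term _ _ _ _ _ _ (hx.size 0) hy.fst hz.snd h1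
  have t2 := term _ _ _ _ _ _ (hx.size 0) hy.snd hz.fst h1
  have t3 := term _ _ _ _ _ _ (hy.size 0) hx.fst hz.snd h2
  have t4 := term _ _ _ _ _ _ (hy.size 0) hx.snd hz.fst h2
  have t5 := term _ _ _ _ _ _ (hz.size 0) hx.fst hy.snd h3
  have t6 := term _ _ _ _ _ _ (hz.size 0) hx.snd hy.fst h3
  have e : ((det3 x y z : ℤ) : ℝ) =
      x 0 * (y 0 * ξ - y 1) * (z 1 * ξ - z 2) - x 0 * (y 1 * ξ - y 2) * (z 0 * ξ - z 1)
      - y 0 * (x 0 * ξ - x 1) * (z 1 * ξ - z 2) + y 0 * (x 1 * ξ - x 2) * (z 0 * ξ - z 1)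
      + z 0 * (x 0 * ξ - x 1) * (y 1 * ξ - y 2) - z 0 * (x 1 * ξ - x 2) * (y 0 * ξ - y 1) := by
    rw [det3]; push_cast; ring
  have hlt : 6 * (C ^ 3 * Real.exp (-(6 * C ^ 3))) < 1 := by
    rw [Real.exp_neg, ← mul_assoc, ← div_eq_mul_inv, div_lt_one (Real.exp_pos _)]
    linarith [Real.add_one_le_exp (6 * C ^ 3)]
  have : |((det3 x y z : ℤ) : ℝ)| < 1 := by
    rw [e, abs_lt]
    rw [abs_le] at t1 t2 t3 t4 t5 t6
    constructor <;> linarith [t1.1, t1.2, t2.1, t2.2, t3.1, t3.2, t4.1, t4.2, t5.1, t5.2, t6.1, t6.2]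
  exact Int.abs_lt_one_iff.1 (by exact_mod_cast this)

/-- A point close to `(1, ξ, ξ ^ 2)` whose size lies in a suitable range is proportional to a
prescribed member of the given sequence of points. -/
lemma exists_proportional {ξ C B : ℝ} {l : ℕ → ℝ} {x : ℕ → Fin 3 → ℤ} (hC : 0 < C) (hB : 0 ≤ B)
    (hx : ∀ i, ApproxPoint ξ C (l i) (x i))
    (hdet : ∀ i, det3 (x i) (x (i + 1)) (x (i + 2)) ≠ 0)
    (hl : ∀ i, |l (i + 1) - gam * l i| ≤ B) (i : ℕ) (z : Fin 3 → ℤ) (t : ℝ)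
    (hi : 100 * (6 * C ^ 3 + B) ≤ l i) (ht1 : 1.2 * l i ≤ t) (ht2 : t ≤ 2.3 * l i)
    (hz : ApproxPoint ξ C t z) :
    ∃ u v : ℤ, u ≠ 0 ∧ ∀ k, u * z k = v * x (i + 1) k := by
  obtain ⟨g1, g2⟩ := gam_bounds
  have hC3 : 0 < C ^ 3 := by positivity
  have a0 := abs_le.1 (hl i)
  have a1 : -B ≤ l (i + 2) - gam * l (i + 1) ∧ l (i + 2) - gam * l (i + 1) ≤ B :=
    abs_le.1 (hl (i + 1))
  have p0 : 0 < l i := by linarith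
  have b1 : 1.61 * l i ≤ gam * l i := by gcongr
  have b2 : gam * l i ≤ 1.62 * l i := by gcongr
  have p1 : 0 < l (i + 1) := by linarith
  have c1 : 1.61 * l (i + 1) ≤ gam * l (i + 1) := by gcongr
  have c2 : gam * l (i + 1) ≤ 1.62 * l (i + 1) := by gcongr
  have d1 := det3_eq_zero hC (hx i) (hx (i + 1)) hz (by linarith) (by linarith) (by linarith)
  have d2 := det3_eq_zero hC (hx (i + 1)) (hx (i + 2)) hz (by linarith) (by linarith) (by linarith)
  refine ⟨det3 (x i) (x (i + 1)) (x (i + 2)), det3 (x i) z (x (i + 2)), hdet i, fun k => ?_⟩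
  unfold det3 at *
  fin_cases k
  · simp only [Fin.zero_eta]
    linear_combination (x i 0) * d2 + (x (i + 2) 0) * d1
  · simp only [Fin.mk_one]
    linear_combination (x i 1) * d2 + (x (i + 2) 1) * d1
  · simp only [Fin.reduceFinMk]
    linear_combination (x i 2) * d2 + (x (i + 2) 2) * d1

lemma sq_ne_two_mul_sq (a b : ℤ) (hb : b ≠ 0) : a ^ 2 ≠ 2 * b ^ 2 := by
  intro h
  refine irrational_sqrt_two ⟨|(a : ℚ) / b|, ?_⟩
  have hb' : (b : ℝ) ≠ 0 := by exact_mod_cast hb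
  have h' : (a : ℝ) ^ 2 = 2 * b ^ 2 := by exact_mod_cast h
  push_cast
  rw [← Real.sqrt_sq_eq_abs, div_pow, h']
  congr 1
  field_simp

/-- Two families of points close to `(1, ξ, ξ ^ 2)`, with the same growth, one with determinants of
constant absolute value and the other with determinants alternating between `±1` and `±2`, cannot
coexist. -/
lemma no_constant_disc {ξ C B C' B' : ℝ} {l l' : ℕ → ℝ} {x z : ℕ → Fin 3 → ℤ}
    (hC : 0 < C) (hB : 0 ≤ B)
    (hx : ∀ i, ApproxPoint ξ C (l i) (x i))
    (hdet : ∀ i, det3 (x i) (x (i + 1)) (x (i + 2)) ≠ 0)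
    (hl : ∀ i, |l (i + 1) - gam * l i| ≤ B)
    (hdisc : ∀ i, ∃ j ≤ 2, ∃ k ≤ 2, |disc (x (i + j))| = 1 ∧ |disc (x (i + k))| = 2)
    (hlim : ∀ T, ∃ i₀, ∀ i ≥ i₀, T ≤ l i)
    (hz : ∀ j, ApproxPoint ξ C' (l' j) (z j)) (hl' : ∀ j, |l' (j + 1) - gam * l' j| ≤ B')
    (hlim' : ∀ T, ∃ j, T ≤ l' j) (E : ℤ) (hE : E ≠ 0) (hzE : ∀ j, |disc (z j)| = E) : False := by
  obtain ⟨g1, g2⟩ := gam_bounds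
  set K := max C C'
  have hK : 0 < K := lt_max_of_lt_left hC
  set b := max B B'
  have hBb : B ≤ b := le_max_left _ _
  have hBb' : B' ≤ b := le_max_right _ _
  have hb : 0 ≤ b := hB.trans hBb
  have hx' : ∀ i, ApproxPoint ξ K (l i) (x i) := fun i => (hx i).mono (le_max_left _ _)
  have hz' : ∀ i, ApproxPoint ξ K (l' i) (z i) := fun i => (hz i).mono (le_max_right _ _)
  obtain ⟨i₀, hi₀⟩ := hlim (100 * (6 * K ^ 3 + b))
  obtain ⟨j, hj⟩ := hlim' (1.3 * l i₀)
  have hK3 : 0 < K ^ 3 := by positivity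
  have hex : ∃ k, i₀ ≤ k ∧ l' j < 1.3 * l k := by
    obtain ⟨i₁, hi₁⟩ := hlim (|l' j| + 1)
    refine ⟨max i₀ i₁, le_max_left _ _, ?_⟩
    have := hi₁ _ (le_max_right i₀ i₁)
    linarith [le_abs_self (l' j), abs_nonneg (l' j)]
  classical
  obtain ⟨i, hik⟩ : ∃ i, Nat.find hex = i + 1 := by
    refine Nat.exists_eq_succ_of_ne_zero fun h0 => ?_
    have hs := Nat.find_spec hex
    rw [h0] at hs
    have : i₀ = 0 := by omega
    subst this
    linarith [hs.2]
  obtain ⟨hs1, hs2⟩ := Nat.find_spec hex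
  rw [hik] at hs1 hs2
  have hii : i₀ ≤ i := by
    by_contra hcon
    have : i₀ = i + 1 := by omega
    subst this
    linarith
  have hlow : 1.3 * l i ≤ l' j := by
    by_contra hcon
    exact Nat.find_min hex (m := i) (by omega) ⟨hii, not_le.1 hcon⟩
  have bnd : ∀ (f : ℕ → ℝ) (n : ℕ), |f (n + 1) - gam * f n| ≤ b → 0 ≤ f n →
      1.61 * f n - b ≤ f (n + 1) ∧ f (n + 1) ≤ 1.62 * f n + b := by
    intro f n h hp
    have := abs_le.1 h
    have b1 : 1.61 * f n ≤ gam * f n := by gcongr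
    have b2 : gam * f n ≤ 1.62 * f n := by gcongr
    constructor <;> linarith
  have q0 := hi₀ i hii
  have q1 := hi₀ (i + 1) (by omega)
  have q2 := hi₀ (i + 2) (by omega)
  have r0 := bnd l i ((hl i).trans hBb) (by linarith)
  have r1 : _ ∧ l (i + 2) ≤ _ := bnd l (i + 1) ((hl _).trans hBb) (by linarith)
  have s0 := bnd l' j ((hl' j).trans hBb') (by linarith)
  have s1 : _ ∧ l' (j + 2) ≤ _ := bnd l' (j + 1) ((hl' _).trans hBb') (by linarith)
  have hlb : ∀ i, |l (i + 1) - gam * l i| ≤ b := fun i => (hl i).trans hBb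
  have prop : ∀ n ≤ 2, ∃ u v : ℤ, u ≠ 0 ∧ ∀ k, u * z (j + n) k = v * x (i + 1 + n) k := by
    intro n hn
    have : n = 0 ∨ n = 1 ∨ n = 2 := by omega
    rcases this with rfl | rfl | rfl
    · exact exists_proportional hK hb hx' hdet hlb i _ _ q0 (by linarith) (by linarith) (hz' j)
    · exact exists_proportional hK hb hx' hdet hlb (i + 1) _ _ q1 (by linarith) (by linarith)
        (hz' (j + 1))
    · exact exists_proportional hK hb hx' hdet hlb (i + 2) _ _ q2 (by linarith) (by linarith)
        (hz' (j + 2))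
  have prop' : ∀ n ≤ 2, ∃ u v : ℤ, u ≠ 0 ∧ u ^ 2 * E = v ^ 2 * |disc (x (i + 1 + n))| := by
    intro n hn
    obtain ⟨u, v, hu, h⟩ := prop n hn
    refine ⟨u, v, hu, ?_⟩
    have : u ^ 2 * disc (z (j + n)) = v ^ 2 * disc (x (i + 1 + n)) := by
      have h0 := h 0
      have h1 := h 1
      have h2 := h 2
      unfold disc
      linear_combination u * z (j + n) 2 * h0 + v * x (i + 1 + n) 0 * h2
        - (u * z (j + n) 1 + v * x (i + 1 + n) 1) * h1
    rw [← hzE (j + n), ← abs_sq u, ← abs_sq v, ← abs_mul, ← abs_mul, this]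
  obtain ⟨a, ha, c, hc, h1, h2⟩ := hdisc (i + 1)
  obtain ⟨u, v, hu, h⟩ := prop' a ha
  obtain ⟨u', v', hu', h'⟩ := prop' c hc
  rw [h1] at h
  rw [h2] at h'
  have hv' : v' ≠ 0 := by
    rintro rfl
    have : u' ^ 2 * E = 0 := by rw [h']; ring
    simp [hu', hE] at this
  exact sq_ne_two_mul_sq (v * u') (v' * u) (mul_ne_zero hv' hu)
    (by linear_combination -(u' ^ 2) * h + u ^ 2 * h')

lemma eq_zero_of_det3_ne_zero {x y z : Fin 3 → ℤ} (h : det3 x y z ≠ 0) {a b c : ℤ}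
    (hx : c * x 0 + b * x 1 + a * x 2 = 0) (hy : c * y 0 + b * y 1 + a * y 2 = 0)
    (hz : c * z 0 + b * z 1 + a * z 2 = 0) : a = 0 ∧ b = 0 ∧ c = 0 := by
  refine ⟨?_, ?_, ?_⟩ <;> refine (mul_eq_zero.1 ?_).resolve_left h <;> unfold det3
  · linear_combination (y 0 * z 1 - y 1 * z 0) * hx - (x 0 * z 1 - x 1 * z 0) * hy
      + (x 0 * y 1 - x 1 * y 0) * hz
  · linear_combination -(y 0 * z 2 - y 2 * z 0) * hx + (x 0 * z 2 - x 2 * z 0) * hy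
      - (x 0 * y 2 - x 2 * y 0) * hz
  · linear_combination (y 1 * z 2 - y 2 * z 1) * hx - (x 1 * z 2 - x 2 * z 1) * hy
      + (x 1 * y 2 - x 2 * y 1) * hz

lemma exists_common_denominator (a b c d : ℚ) :
    ∃ (D a' b' c' d' : ℤ), D ≠ 0 ∧ D * a = a' ∧ D * b = b' ∧ D * c = c' ∧ D * d = d' := by
  refine ⟨a.den * b.den * c.den * d.den, a.num * b.den * c.den * d.den,
    a.den * b.num * c.den * d.den, a.den * b.den * c.num * d.den, a.den * b.den * c.den * d.num,
    ?_, ?_, ?_, ?_, ?_⟩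
  · have := a.den_nz; have := b.den_nz; have := c.den_nz; have := d.den_nz
    positivity
  · push_cast; linear_combination (b.den * c.den * d.den : ℚ) * a.mul_den_eq_num
  · push_cast; linear_combination (a.den * c.den * d.den : ℚ) * b.mul_den_eq_num
  · push_cast; linear_combination (a.den * b.den * d.den : ℚ) * c.mul_den_eq_num
  · push_cast; linear_combination (a.den * b.den * c.den : ℚ) * d.mul_den_eq_num

lemma exp_small (M : ℝ) {t : ℝ} (h : M < t) : M * Real.exp (-t) < 1 := by
  rw [Real.exp_neg, ← div_eq_mul_inv, div_lt_one (Real.exp_pos _)]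
  linarith [Real.add_one_le_exp t]

lemma not_quadratic {ξ C : ℝ} {l : ℕ → ℝ} {x : ℕ → Fin 3 → ℤ}
    (hx : ∀ i, ApproxPoint ξ C (l i) (x i))
    (hdet : ∀ i, det3 (x i) (x (i + 1)) (x (i + 2)) ≠ 0)
    (hlim : ∀ T, ∃ i₀, ∀ i ≥ i₀, T ≤ l i) (a b c : ℚ) (h : ¬(a = 0 ∧ b = 0 ∧ c = 0)) :
    (a : ℝ) * ξ ^ 2 + (b : ℝ) * ξ + (c : ℝ) ≠ 0 := by
  intro heq
  obtain ⟨D, a', b', c', -, hD, ha, hb, hc, -⟩ := exists_common_denominator a b c 0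
  have ha' : (D : ℝ) * a = a' := by exact_mod_cast ha
  have hb' : (D : ℝ) * b = b' := by exact_mod_cast hb
  have hc' : (D : ℝ) * c = c' := by exact_mod_cast hc
  have heq' : (a' : ℝ) * ξ ^ 2 + b' * ξ + c' = 0 := by
    linear_combination (D : ℝ) * heq - ξ ^ 2 * ha' - ξ * hb' - hc'
  obtain ⟨i₀, hi₀⟩ := hlim ((|(a' : ℝ)| + |a' * ξ + b'|) * C + 1)
  have van : ∀ i ≥ i₀, c' * x i 0 + b' * x i 1 + a' * x i 2 = 0 := by
    intro i hi
    have e : ((c' * x i 0 + b' * x i 1 + a' * x i 2 : ℤ) : ℝ) =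
        -(a' * (x i 1 * ξ - x i 2)) - (a' * ξ + b') * (x i 0 * ξ - x i 1) := by
      push_cast
      linear_combination (x i 0 : ℝ) * heq'
    have hlt : |((c' * x i 0 + b' * x i 1 + a' * x i 2 : ℤ) : ℝ)| < 1 := by
      rw [e]
      refine (abs_sub _ _).trans_lt ?_
      rw [abs_neg, abs_mul, abs_mul]
      calc |(a' : ℝ)| * |x i 1 * ξ - x i 2| + |a' * ξ + b'| * |x i 0 * ξ - x i 1|
          ≤ |(a' : ℝ)| * (C * Real.exp (-l i)) + |a' * ξ + b'| * (C * Real.exp (-l i)) := by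
            gcongr
            · exact (hx i).snd
            · exact (hx i).fst
        _ = ((|(a' : ℝ)| + |a' * ξ + b'|) * C) * Real.exp (-l i) := by ring
        _ < 1 := exp_small _ (by linarith [hi₀ i hi])
    exact Int.abs_lt_one_iff.1 (by exact_mod_cast hlt)
  obtain ⟨h1, h2, h3⟩ := eq_zero_of_det3_ne_zero (hdet i₀) (van i₀ le_rfl)
    (van (i₀ + 1) (by omega)) (van (i₀ + 2) (by omega))
  have hDq : (D : ℚ) ≠ 0 := by exact_mod_cast hD
  subst h1 h2 h3
  apply h
  simp only [Int.cast_zero, mul_eq_zero, hDq, false_or] at ha hb hc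
  exact ⟨ha, hb, hc⟩

lemma isExtremal_of_approx {ξ C B : ℝ} {l : ℕ → ℝ} {x : ℕ → Fin 3 → ℤ} (hC : 1 ≤ C)
    (hx : ∀ i, ApproxPoint ξ C (l i) (x i))
    (hdet : ∀ i, det3 (x i) (x (i + 1)) (x (i + 2)) ≠ 0)
    (hl : ∀ i, |l (i + 1) - gam * l i| ≤ B) (hlim : ∀ T, ∃ i₀, ∀ i ≥ i₀, T ≤ l i) :
    IsExtremal ξ := by
  obtain ⟨g1, g2⟩ := gam_bounds
  have hg : 0 < gam := by linarith
  have hC0 : 0 < C := by linarith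
  refine ⟨not_quadratic hx hdet hlim, ?_⟩
  set U := (|ξ| + |ξ ^ 2| + 1) * Real.exp (1 / gam * (Real.log C + l 0)) with hU
  set V := C * (|ξ| + 1) * Real.exp (1 / gam * (Real.log C + B)) with hV
  have hU0 : 0 < U := by positivity
  have hV0 : 0 < V := by positivity
  refine ⟨max U V, lt_max_of_lt_left hU0, fun X hX => ?_⟩
  have hX0 : 0 < X := by linarith
  have hpow : X ^ (-1 / gam) = Real.exp (-(1 / gam * Real.log X)) := by
    rw [Real.rpow_def_of_pos hX0]; congr 1; ring
  rw [hpow]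
  have hex : ∃ k, Real.log X < Real.log C + l k := by
    obtain ⟨k, hk⟩ := hlim (Real.log X - Real.log C + 1)
    exact ⟨k, by linarith [hk k le_rfl]⟩
  classical
  rcases Nat.eq_zero_or_pos (Nat.find hex) with h0 | h0
  · have hs := Nat.find_spec hex
    rw [h0] at hs
    have hle : |ξ| + |ξ ^ 2| + 1 ≤ max U V * Real.exp (-(1 / gam * Real.log X)) := by
      have h1 : 1 / gam * Real.log X ≤ 1 / gam * (Real.log C + l 0) := by gcongr
      calc |ξ| + |ξ ^ 2| + 1 = U * Real.exp (-(1 / gam * (Real.log C + l 0))) := by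
            rw [hU, mul_assoc, ← Real.exp_add]; simp
        _ ≤ max U V * Real.exp (-(1 / gam * Real.log X)) := by
            gcongr
            exact le_max_left _ _
    refine ⟨1, 0, 0, by simp, by simpa using hX, ?_, ?_⟩
    · push_cast
      rw [one_mul, sub_zero]
      linarith [abs_nonneg (ξ ^ 2)]
    · push_cast
      rw [one_mul, sub_zero]
      linarith [abs_nonneg ξ]
  · obtain ⟨i, hi⟩ := Nat.exists_eq_succ_of_ne_zero h0.ne'
    have hs := Nat.find_spec hex
    rw [hi] at hs
    have hs' : Real.log X < Real.log C + l (i + 1) := hs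
    have hm : Real.log C + l i ≤ Real.log X := not_lt.1 (Nat.find_min hex (by omega))
    have hle : C * (|ξ| + 1) * Real.exp (-l i) ≤ max U V * Real.exp (-(1 / gam * Real.log X)) := by
      have h1 : 1 / gam * Real.log X ≤ 1 / gam * (Real.log C + B + gam * l i) := by
        gcongr
        linarith [(abs_le.1 (hl i)).2]
      have h2 : 1 / gam * (Real.log C + B + gam * l i) = 1 / gam * (Real.log C + B) + l i := by
        field_simp
      calc C * (|ξ| + 1) * Real.exp (-l i)
          = V * Real.exp (-(1 / gam * (Real.log C + B + gam * l i))) := by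
            rw [hV, mul_assoc, mul_assoc, mul_assoc, ← Real.exp_add, h2, ← mul_assoc]
            ring_nf
        _ ≤ max U V * Real.exp (-(1 / gam * Real.log X)) := by
            gcongr
            exact le_max_right _ _
    have hfst := (hx i).fst
    have hsnd := (hx i).snd
    have hpos : 0 ≤ C * Real.exp (-l i) := by positivity
    refine ⟨x i 0, x i 1, x i 2, ?_, ?_, ?_, ?_⟩
    · rintro ⟨e0, e1, e2⟩
      exact hdet i (by simp [det3, e0, e1, e2])
    · refine ((hx i).size 0).trans ?_
      rw [← Real.exp_log hX0]
      calc C * Real.exp (l i) = Real.exp (Real.log C + l i) := by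
            rw [Real.exp_add, Real.exp_log hC0]
        _ ≤ _ := by gcongr
    · refine hfst.trans (le_trans ?_ hle)
      nlinarith [abs_nonneg ξ]
    · have e : (x i 0 : ℝ) * ξ ^ 2 - x i 2 = ξ * (x i 0 * ξ - x i 1) + (x i 1 * ξ - x i 2) := by
        ring
      rw [e]
      refine (abs_add_le _ _).trans (le_trans ?_ hle)
      rw [abs_mul]
      have := mul_le_mul_of_nonneg_left hfst (abs_nonneg ξ)
      linarith

lemma irrational_of_not_quadratic {ξ : ℝ} (h : ∀ a b c : ℚ, ¬(a = 0 ∧ b = 0 ∧ c = 0) →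
    (a : ℝ) * ξ ^ 2 + (b : ℝ) * ξ + (c : ℝ) ≠ 0) : Irrational ξ := by
  rintro ⟨q, rfl⟩
  exact h 0 1 (-q) (by simp) (by simp)

lemma abs_le_mnorm (A : M2) (i j : Fin 2) : |(A i j : ℝ)| ≤ mnorm A := by
  unfold mnorm
  fin_cases i <;> fin_cases j <;> simp

lemma mnorm_pos {A : M2} (h : A.det ≠ 0) : 0 < mnorm A := by
  by_contra hcon
  apply h
  have z : ∀ i j, A i j = 0 := fun i j => by
    have := (abs_le_mnorm A i j).trans (not_lt.1 hcon)
    exact_mod_cast abs_nonpos_iff.1 this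
  simp [Matrix.det_fin_two, z]

lemma abs_entry_le_xiNorm (ξ : ℝ) (A : M2) (j : Fin 2) :
    |ξ * (A 0 j : ℝ) - (A 1 j : ℝ)| ≤ xiNorm ξ A := by
  unfold xiNorm
  fin_cases j <;> simp

lemma abs_mul_apply_le {A B : M2} {a b : ℝ} (ha : ∀ i j, |(A i j : ℝ)| ≤ a)
    (hb : ∀ i j, |(B i j : ℝ)| ≤ b) (i j : Fin 2) : |((A * B) i j : ℝ)| ≤ 2 * a * b := by
  rw [Matrix.mul_apply, Fin.sum_univ_two]
  push_cast
  refine (abs_add_le _ _).trans ?_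
  rw [abs_mul, abs_mul]
  have ha0 : 0 ≤ a := (abs_nonneg _).trans (ha 0 0)
  have h1 : |(A i 0 : ℝ)| * |(B 0 j : ℝ)| ≤ a * b := by gcongr <;> apply_assumption
  have h2 : |(A i 1 : ℝ)| * |(B 1 j : ℝ)| ≤ a * b := by gcongr <;> apply_assumption
  linarith

lemma abs_row_mul_le {ξ e b : ℝ} {A B : M2} (ha : ∀ j, |ξ * (A 0 j : ℝ) - (A 1 j : ℝ)| ≤ e)
    (hb : ∀ i j, |(B i j : ℝ)| ≤ b) (j : Fin 2) :
    |ξ * ((A * B) 0 j : ℝ) - ((A * B) 1 j : ℝ)| ≤ 2 * e * b := by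
  have eq : ξ * ((A * B) 0 j : ℝ) - ((A * B) 1 j : ℝ) =
      (ξ * (A 0 0 : ℝ) - (A 1 0 : ℝ)) * B 0 j + (ξ * (A 0 1 : ℝ) - (A 1 1 : ℝ)) * B 1 j := by
    simp only [Matrix.mul_apply, Fin.sum_univ_two]
    push_cast
    ring
  rw [eq]
  refine (abs_add_le _ _).trans ?_
  rw [abs_mul, abs_mul]
  have he0 : 0 ≤ e := (abs_nonneg _).trans (ha 0)
  have h1 : |ξ * (A 0 0 : ℝ) - (A 1 0 : ℝ)| * |(B 0 j : ℝ)| ≤ e * b := by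
    gcongr <;> apply_assumption
  have h2 : |ξ * (A 0 1 : ℝ) - (A 1 1 : ℝ)| * |(B 1 j : ℝ)| ≤ e * b := by
    gcongr <;> apply_assumption
  linarith

/-- A real number conjugate to one having an associated Fibonacci sequence in `GL₂(ℤ)` admits
a sequence of approximating points with determinants of constant absolute value. -/
lemma exists_points_of_hasGLAssoc {ξ : ℝ} (hξ : Irrational ξ) (A : Matrix (Fin 2) (Fin 2) ℚ)
    (hA : A.det ≠ 0)
    (h : HasGLAssoc (((A 0 0 : ℝ) * ξ + (A 0 1 : ℝ)) / ((A 1 0 : ℝ) * ξ + (A 1 1 : ℝ)))) :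
    ∃ (C B : ℝ) (l : ℕ → ℝ) (z : ℕ → Fin 3 → ℤ) (E : ℤ), E ≠ 0 ∧
      (∀ j, ApproxPoint ξ C (l j) (z j)) ∧ (∀ j, |l (j + 1) - gam * l j| ≤ B) ∧
      (∀ T, ∃ j, T ≤ l j) ∧ ∀ j, |disc (z j)| = E := by
  obtain ⟨-, W, ⟨-, hunb, ⟨N, hN, -, -, hsymm⟩, c₁, c₂, c₃, c₄, c₅, c₆, hc1, hc2, -, hc4, -, -, hW⟩,
    hGL⟩ := h
  set η := ((A 0 0 : ℝ) * ξ + (A 0 1 : ℝ)) / ((A 1 0 : ℝ) * ξ + (A 1 1 : ℝ)) with hη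
  have hden : (A 1 0 : ℝ) * ξ + (A 1 1 : ℝ) ≠ 0 := by
    intro h0
    by_cases hc : A 1 0 = 0
    · have : A 1 1 = 0 := by rw [hc] at h0; simpa using h0
      exact hA (by simp [Matrix.det_fin_two, hc, this])
    · refine hξ ⟨-A 1 1 / A 1 0, ?_⟩
      have hc' : (A 1 0 : ℝ) ≠ 0 := by exact_mod_cast hc
      push_cast
      field_simp
      linarith
  obtain ⟨D, a, b, c, d, hD, ha, hb, hc, hd⟩ :=
    exists_common_denominator (A 0 0) (A 0 1) (A 1 0) (A 1 1)
  have ha' : (D : ℝ) * A 0 0 = a := by exact_mod_cast ha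
  have hb' : (D : ℝ) * A 0 1 = b := by exact_mod_cast hb
  have hc' : (D : ℝ) * A 1 0 = c := by exact_mod_cast hc
  have hd' : (D : ℝ) * A 1 1 = d := by exact_mod_cast hd
  set M : M2 := !![a, -c; -b, d] with hM
  have hMdet : M.det ≠ 0 := by
    have e : ((M.det : ℤ) : ℚ) = D ^ 2 * A.det := by
      rw [hM, Matrix.det_fin_two, Matrix.det_fin_two]
      simp
      rw [← ha, ← hb, ← hc, ← hd]; ring
    intro h0
    rw [h0] at e
    have hDq : (D : ℚ) ≠ 0 := by exact_mod_cast hD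
    exact mul_ne_zero (pow_ne_zero 2 hDq) hA (by rw [← e]; simp)
  set μ : ℝ := c * ξ + d with hμ
  have hμη : ξ * a + b = μ * η := by
    rw [hη, hμ, ← ha', ← hb', ← hc', ← hd', mul_div_assoc', eq_div_iff hden]
    ring
  set N' : ℕ → M2 := fun i => if i % 2 = 1 then Nᵀ else N with hN'
  have hN'det : ∀ i, (N' i).det = N.det := by
    intro i; simp only [hN']; split_ifs <;> simp
  have hN'le : ∀ i j k, |(N' i j k : ℝ)| ≤ mnorm N := by
    intro i j k; simp only [hN']; split_ifs
    · exact abs_le_mnorm N k j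
    · exact abs_le_mnorm N j k
  set Y : ℕ → M2 := fun i => W i * N' i with hY
  set Z : ℕ → M2 := fun i => M * (Y i * Mᵀ) with hZ
  have hYs : ∀ i, 1 ≤ i → (Y i)ᵀ = Y i := fun i hi => hsymm i hi
  have hZs : ∀ i, 1 ≤ i → Z i 1 0 = Z i 0 1 := by
    intro i hi
    have : (Z i)ᵀ = Z i := by
      simp only [hZ, Matrix.transpose_mul, Matrix.transpose_transpose, hYs i hi, Matrix.mul_assoc]
    exact congrFun (congrFun this 0) 1
  have hWdet : ∀ i, 1 ≤ i → |(W i).det| = 1 := by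
    intro i hi
    rcases hGL i hi with h | h <;> simp [h]
  have hWpos : ∀ i, 1 ≤ i → 0 < mnorm (W i) := fun i hi =>
    mnorm_pos fun h0 => by have := hWdet i hi; simp [h0] at this
  have hZrow : ∀ i j, ξ * (Z i 0 j : ℝ) - (Z i 1 j : ℝ) =
      μ * (η * ((Y i * Mᵀ) 0 j : ℝ) - ((Y i * Mᵀ) 1 j : ℝ)) := by
    intro i j
    simp only [hZ]
    generalize Y i * Mᵀ = R
    simp only [hM, Matrix.mul_apply, Fin.sum_univ_two]
    simp
    linear_combination (R 0 j : ℝ) * hμη - (R 1 j : ℝ) * hμ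
  set n := mnorm N
  set m := mnorm M
  have hMt : ∀ i j, |(Mᵀ i j : ℝ)| ≤ m := fun i j => abs_le_mnorm M j i
  have hn0 : 0 ≤ n := (abs_nonneg _).trans (abs_le_mnorm N 0 0)
  have hm0 : 0 ≤ m := (abs_nonneg _).trans (abs_le_mnorm M 0 0)
  have hsize : ∀ i j k, |(Z i j k : ℝ)| ≤ (8 * m ^ 2 * n) * mnorm (W i) := by
    intro i j k
    have h1 := abs_mul_apply_le (abs_le_mnorm M)
      (abs_mul_apply_le (abs_mul_apply_le (abs_le_mnorm (W i)) (hN'le i)) hMt) j k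
    refine h1.trans (le_of_eq ?_)
    ring
  have hrow : ∀ i, 1 ≤ i → ∀ j, |ξ * (Z i 0 j : ℝ) - (Z i 1 j : ℝ)| ≤
      (4 * |μ| * c₄ * m * n) * (mnorm (W i))⁻¹ := by
    intro i hi j
    have h0 : ∀ j, |η * (W i 0 j : ℝ) - (W i 1 j : ℝ)| ≤ c₄ * (mnorm (W i))⁻¹ := fun j =>
      (abs_entry_le_xiNorm η (W i) j).trans (hW i hi).2.2.2.1
    have h1 := abs_row_mul_le (abs_row_mul_le h0 (hN'le i)) hMt j
    rw [hZrow, abs_mul]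
    calc |μ| * _ ≤ |μ| * _ := mul_le_mul_of_nonneg_left h1 (abs_nonneg μ)
      _ = _ := by ring
  have hdisc : ∀ i, 1 ≤ i → |Z i 0 0 * Z i 1 1 - Z i 0 1 ^ 2| = |M.det ^ 2 * N.det| := by
    intro i hi
    have e : Z i 0 0 * Z i 1 1 - Z i 0 1 ^ 2 = M.det ^ 2 * N.det * (W i).det := by
      have : (Z i).det = M.det ^ 2 * N.det * (W i).det := by
        simp only [hZ, hY, Matrix.det_mul, Matrix.det_transpose, hN'det]; ring
      rw [← this, Matrix.det_fin_two, hZs i hi]; ring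
    rw [e, abs_mul, hWdet i hi, mul_one]
  refine ⟨max (8 * m ^ 2 * n) (4 * |μ| * c₄ * m * n), |Real.log c₁| + |Real.log c₂|,
    fun j => Real.log (mnorm (W (j + 1))), fun j => ![Z (j + 1) 0 0, Z (j + 1) 0 1, Z (j + 1) 1 1],
    |M.det ^ 2 * N.det|, ?_, ?_, ?_, ?_, ?_⟩
  · exact abs_ne_zero.2 (mul_ne_zero (pow_ne_zero 2 hMdet) hN.2)
  · intro j
    have hp := hWpos (j + 1) (by omega)
    refine ⟨?_, ?_, ?_⟩
    · intro k
      rw [Real.exp_log hp]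
      have key : ∀ a b, |(Z (j + 1) a b : ℝ)| ≤
          max (8 * m ^ 2 * n) (4 * |μ| * c₄ * m * n) * mnorm (W (j + 1)) := fun a b =>
        (hsize (j + 1) a b).trans (by gcongr; exact le_max_left _ _)
      fin_cases k
      · exact key 0 0
      · exact key 0 1
      · exact key 1 1
    · rw [Real.exp_neg, Real.exp_log hp]
      have h1 := hrow (j + 1) (by omega) 0
      rw [hZs (j + 1) (by omega), mul_comm ξ] at h1
      exact h1.trans (by gcongr; exact le_max_right _ _)
    · rw [Real.exp_neg, Real.exp_log hp]
      have h1 := hrow (j + 1) (by omega) 1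
      rw [mul_comm ξ] at h1
      exact h1.trans (by gcongr; exact le_max_right _ _)
  · intro j
    have hp := hWpos (j + 1) (by omega)
    have hp' := hWpos (j + 1 + 1) (by omega)
    obtain ⟨h1, h2, -⟩ := hW (j + 1) (by omega)
    have hpg : 0 < mnorm (W (j + 1)) ^ gam := Real.rpow_pos_of_pos hp _
    have l1 := Real.log_le_log (mul_pos hc1 hpg) h1
    have l2 := Real.log_le_log hp' h2
    rw [Real.log_mul hc1.ne' hpg.ne', Real.log_rpow hp] at l1
    rw [Real.log_mul hc2.ne' hpg.ne', Real.log_rpow hp] at l2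
    rw [abs_le]
    constructor
    · linarith [neg_abs_le (Real.log c₁), abs_nonneg (Real.log c₂)]
    · linarith [le_abs_self (Real.log c₂), abs_nonneg (Real.log c₁)]
  · intro T
    obtain ⟨i, hi, h⟩ := hunb (Real.exp T)
    obtain ⟨j, rfl⟩ := Nat.exists_eq_add_of_le' hi
    exact ⟨j, (Real.le_log_iff_exp_le (hWpos _ hi)).2 h.le⟩
  · intro j
    exact hdisc (j + 1) (by omega)

lemma badlyApprox_cf_limit {θ : ℝ} (hθ : ∀ n, |den n * θ - num n| ≤ 2 / den (n + 1))
    (hirr : Irrational (θ / √2)) : BadlyApprox (θ / √2) := by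
  have hs2 : √2 ≤ (1.5 : ℝ) := Real.sqrt_le_iff.2 (by norm_num)
  have hs0 : 0 < √2 := by positivity
  refine ⟨hirr, 1 / 100, by norm_num, fun p q hq => ?_⟩
  have h := cf_limit_lower θ hθ p q hq
  have hq' : (q : ℝ) ≠ 0 := by exact_mod_cast hq
  have hq0 : 0 < |(q : ℝ)| := abs_pos.2 hq'
  have e : (q : ℝ) * θ - √2 * p = √2 * (q * (θ / √2 - p / q)) := by field_simp
  rw [e, abs_mul, abs_mul, abs_of_pos hs0] at h
  rw [← sq_abs (q : ℝ), div_lt_iff₀ (by positivity)]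
  set δ := |θ / √2 - p / q|
  have hδ : 0 ≤ δ * |(q : ℝ)| ^ 2 := by positivity
  have h1 : 1 ≤ 34 * √2 * (δ * |(q : ℝ)| ^ 2) := by linarith
  have h2 : 34 * √2 * (δ * |(q : ℝ)| ^ 2) ≤ 34 * 1.5 * (δ * |(q : ℝ)| ^ 2) := by gcongr
  linarith

/-- There exists a badly approximable extremal real number which is not conjugate under
GL₂(ℚ) to any extremal real number with an associated Fibonacci sequence in GL₂(ℤ). -/
theorem stmt7 :
    ∃ ξ : ℝ, IsExtremal ξ ∧ BadlyApprox ξ ∧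
      ∀ A : Matrix (Fin 2) (Fin 2) ℚ, A.det ≠ 0 →
        ¬ HasGLAssoc (((A 0 0 : ℝ) * ξ + (A 0 1 : ℝ)) / ((A 1 0 : ℝ) * ξ + (A 1 1 : ℝ))) := by
  obtain ⟨θ, hθ⟩ := exists_cf_limit
  obtain ⟨l, x, hx, h0, h1, hrec, hdet, hdisc⟩ := exists_fib_points θ hθ
  obtain ⟨B, hB, hl⟩ := exists_golden_bound l _ hrec
  obtain ⟨m, hm, hgrow⟩ := linear_growth l h0 h1 fun i => (hrec i).1
  have hlim : ∀ T, ∃ i₀, ∀ i ≥ i₀, T ≤ l i := by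
    intro T
    obtain ⟨i₀, hi₀⟩ := exists_nat_ge (T / m)
    refine ⟨i₀, fun i hi => ?_⟩
    have h2 : (i₀ : ℝ) ≤ i := by exact_mod_cast hi
    rw [div_le_iff₀ hm] at hi₀
    nlinarith [hgrow i]
  have hext := isExtremal_of_approx (by norm_num) hx hdet hl hlim
  have hirr := irrational_of_not_quadratic hext.1
  refine ⟨θ / √2, hext, badlyApprox_cf_limit hθ hirr, fun A hA hGL => ?_⟩
  obtain ⟨C', B', l', z, E, hE, hz, hl', hlim', hzE⟩ := exists_points_of_hasGLAssoc hirr A hA hGL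
  exact no_constant_disc (by norm_num) hB hx hdet hl hdisc hlim hz hl' hlim' E hE hzE
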